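/- Let 𝒪 ⊂ ℝ^{m−1} × ℝ^n be open, w = (w₂,…,w_m) ∈ C(𝒪, ℝ^{m−1}), and let ψ ∈ C(𝒪, ℝ) be a broad* solution of (D₂^ψψ,…,D_m^ψψ) = w in 𝒪 which moreover belongs to h^{1/2}_{loc}(𝒪), i.e. for every compact K ⊂ 𝒪, lim_{r→0⁺} sup { |ψ(A) − ψ(A')| / |A − A'|^{1/2} : A, A' ∈ K, 0 < |A − A'| ≤ r } = 0 (Euclidean norm). Then ψ is uniformly intrinsically differentiable at every point of 𝒪, and its intrinsic gradient satisfies ∇^ψψ(A) = w(A) for all A ∈ 𝒪. -/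

import Mathlib

noncomputable section

open Set Filter Topology MeasureTheory

namespace Carnot

/-- Euclidean norm on `Fin d → ℝ`. -/
def enorm {d : ℕ} (x : Fin d → ℝ) : ℝ := Real.sqrt (∑ i, (x i) ^ 2)

/-- The underlying set of the Carnot group `G = ℝ^m × ℝ^n` of class `𝓑`. -/
abbrev G (m n : ℕ) := (Fin m → ℝ) × (Fin n → ℝ)

/-- Points of the normal complement `W`, identified with `ℝ^(m-k) × ℝ^n`. -/
abbrev W (m n k : ℕ) := (Fin (m - k) → ℝ) × (Fin n → ℝ)

/-- The group law of the Carnot group of class `𝓑` associated with the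
skew-symmetric matrices `b s`:
`(x,y)·(x',y') = (x + x', y + y' + ½⟨Bx,x'⟩)`. -/
def gmul {m n : ℕ} (b : Fin n → Matrix (Fin m) (Fin m) ℝ) (P Q : G m n) : G m n :=
  (P.1 + Q.1, fun s => P.2 s + Q.2 s + (1 / 2) * ∑ i, ∑ j, b s i j * P.1 j * Q.1 i)

/-- The group inverse `(x,y)⁻¹ = (-x,-y)`. -/
def ginv {m n : ℕ} (P : G m n) : G m n := (-P.1, -P.2)

/-- The homogeneous quasi-norm `N(x,y) = |x| + |y|^(1/2)`. -/
def qnorm {m n : ℕ} (P : G m n) : ℝ := enorm P.1 + Real.sqrt (enorm P.2)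

/-- Open ball for the quasi-norm: `U(P,r) = {Q : N(P⁻¹·Q) < r}`. -/
def ball (m n : ℕ) (b : Fin n → Matrix (Fin m) (Fin m) ℝ) (P : G m n) (r : ℝ) : Set (G m n) :=
  {Q | qnorm (gmul b (ginv P) Q) < r}

/-- The embedding `i : ℝ^(m-k) × ℝ^n → G`, `i(a,α) = (0,…,0,a,α)`. -/
def embW (m n k : ℕ) (A : W m n k) : G m n :=
  (fun j => if h : (j : ℕ) < k then 0 else A.1 ⟨(j : ℕ) - k, by have := j.isLt; omega⟩, A.2)

/-- The embedding of `ℝ^k` as the horizontal subgroup `H`, `v ↦ (v,0,…,0)`. -/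
def embH (m n k : ℕ) (v : Fin k → ℝ) : G m n :=
  (fun j => if h : (j : ℕ) < k then v ⟨(j : ℕ), h⟩ else 0, 0)

/-- The graph map `Φ(A) = i(A)·φ̂(A)`. -/
def graphMap (m n k : ℕ) (b : Fin n → Matrix (Fin m) (Fin m) ℝ)
    (φ : W m n k → Fin k → ℝ) (A : W m n k) : G m n :=
  gmul b (embW m n k A) (embH m n k (φ A))

/-- `N(i(A)⁻¹·i(B))`. -/
def dW (m n k : ℕ) (b : Fin n → Matrix (Fin m) (Fin m) ℝ) (A B : W m n k) : ℝ :=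
  qnorm (gmul b (ginv (embW m n k A)) (embW m n k B))

/-- The graph quasi-distance `σ_φ(A,B) = N(φ̂(A)⁻¹·i(A)⁻¹·i(B)·φ̂(A))`. -/
def sigma (m n k : ℕ) (b : Fin n → Matrix (Fin m) (Fin m) ℝ)
    (φ : W m n k → Fin k → ℝ) (A B : W m n k) : ℝ :=
  qnorm (gmul b (gmul b (gmul b (ginv (embH m n k (φ A))) (ginv (embW m n k A)))
    (embW m n k B)) (embH m n k (φ A)))

/-- The matrix `M` satisfies the uniform intrinsic differentiability condition of `φ`
at `A₀ ∈ 𝒪`. -/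
def UID (m n k : ℕ) (b : Fin n → Matrix (Fin m) (Fin m) ℝ) (O : Set (W m n k))
    (φ : W m n k → Fin k → ℝ) (A₀ : W m n k) (M : Matrix (Fin k) (Fin (m - k)) ℝ) : Prop :=
  ∀ ε > 0, ∃ r > 0, ∀ A ∈ O, ∀ B ∈ O,
    dW m n k b A₀ A < r → dW m n k b A B < r → 0 < dW m n k b A B →
    enorm (fun j => φ B j - φ A j - ∑ i, M j i * (B.1 i - A.1 i)) ≤ ε * sigma m n k b φ A B

/-- `f : U → ℝ^k` is of class `C¹_G` with (continuous) horizontal Jacobian `gradf`. -/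
def C1G (m n k : ℕ) (b : Fin n → Matrix (Fin m) (Fin m) ℝ) (U : Set (G m n))
    (f : G m n → Fin k → ℝ) (gradf : G m n → Matrix (Fin k) (Fin m) ℝ) : Prop :=
  ContinuousOn f U ∧ ContinuousOn gradf U ∧
  ∀ P ∈ U, ∀ ε > 0, ∃ r > 0, ∀ Q ∈ U,
    qnorm (gmul b (ginv P) Q) < r →
    enorm (fun j => f Q j - f P j - ∑ i, gradf P j i * (Q.1 i - P.1 i)) ≤
      ε * qnorm (gmul b (ginv P) Q)

/-- The square block `M₁(Q) = (X_i f_j(Q))_{j,i=1,…,k}` of the horizontal Jacobian. -/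
def M1 (m n k : ℕ) (hk : k ≤ m) (gradf : G m n → Matrix (Fin k) (Fin m) ℝ) (Q : G m n) :
    Matrix (Fin k) (Fin k) ℝ :=
  Matrix.of fun j i => gradf Q j (Fin.castLE hk i)

/-- The block `M₂(Q) = (X_{k+i} f_j(Q))_{j=1,…,k; i=1,…,m-k}` of the horizontal Jacobian. -/
def M2 (m n k : ℕ) (gradf : G m n → Matrix (Fin k) (Fin m) ℝ) (Q : G m n) :
    Matrix (Fin k) (Fin (m - k)) ℝ :=
  Matrix.of fun j i => gradf Q j ⟨k + (i : ℕ), by have := i.isLt; omega⟩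

/-! ### The codimension-one case `k = 1` -/

/-- The index of the variable `x_{j+1}`, `j ∈ {2,…,m}`, inside `Fin m`
(recall that points of `ℝ^{m-1} × ℝ^n` are written `(x₂,…,x_m,y₁,…,y_n)`). -/
def idx1 (m : ℕ) (i : Fin (m - 1)) : Fin m := ⟨(i : ℕ) + 1, by have := i.isLt; omega⟩

/-- Scalar version of `C1G`: `f : U → ℝ` of class `C¹_G` with horizontal
gradient `∇_G f = (X₁f,…,X_mf)`. -/
def C1Gs (m n : ℕ) (b : Fin n → Matrix (Fin m) (Fin m) ℝ) (U : Set (G m n))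
    (f : G m n → ℝ) (gradf : G m n → Fin m → ℝ) : Prop :=
  ContinuousOn f U ∧ ContinuousOn gradf U ∧
  ∀ P ∈ U, ∀ ε > 0, ∃ r > 0, ∀ Q ∈ U,
    qnorm (gmul b (ginv P) Q) < r →
    |f Q - f P - ∑ i, gradf P i * (Q.1 i - P.1 i)| ≤ ε * qnorm (gmul b (ginv P) Q)

/-- `ψ : 𝒪 → ℝ` is uniformly intrinsically differentiable at `A₀` with intrinsic
gradient `g ∈ ℝ^{m-1}` (scalar version of `UID`). -/
def UIDs (m n : ℕ) (b : Fin n → Matrix (Fin m) (Fin m) ℝ) (O : Set (W m n 1))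
    (ψ : W m n 1 → ℝ) (A₀ : W m n 1) (g : Fin (m - 1) → ℝ) : Prop :=
  ∀ ε > 0, ∃ r > 0, ∀ A ∈ O, ∀ B ∈ O,
    dW m n 1 b A₀ A < r → dW m n 1 b A B < r → 0 < dW m n 1 b A B →
    |ψ B - ψ A - ∑ i, g i * (B.1 i - A.1 i)| ≤
      ε * sigma m n 1 b (fun A' _ => ψ A') A B

/-- The graph map `Φ(A) = i(A)·ψ̂(A)` for a scalar `ψ`. -/
def graphMapS (m n : ℕ) (b : Fin n → Matrix (Fin m) (Fin m) ℝ)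
    (ψ : W m n 1 → ℝ) (A : W m n 1) : G m n :=
  graphMap m n 1 b (fun A' _ => ψ A') A

/-- The intrinsic derivative `D_j^ψ ψ` of a (C¹) function `ψ : ℝ^{m-1} × ℝ^n → ℝ`:
`D_j^ψψ = ∂_{x_j}ψ + Σ_s (ψ b^s_{j1} + ½ Σ_l x_l b^s_{jl}) ∂_{y_s}ψ`. -/
def Dj (m n : ℕ) (h0 : 0 < m) (b : Fin n → Matrix (Fin m) (Fin m) ℝ)
    (ψ : W m n 1 → ℝ) (j : Fin (m - 1)) (A : W m n 1) : ℝ :=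
  fderiv ℝ ψ A ((Pi.single j 1 : Fin (m - 1) → ℝ), (0 : Fin n → ℝ)) +
    ∑ s, (ψ A * b s (idx1 m j) ⟨0, h0⟩ +
        (1 / 2) * ∑ l, A.1 l * b s (idx1 m j) (idx1 m l)) *
      fderiv ℝ ψ A ((0 : Fin (m - 1) → ℝ), (Pi.single s 1 : Fin n → ℝ))

/-- Euclidean norm on `ℝ^d × ℝ^e`. -/
def enormP {d e : ℕ} (P : (Fin d → ℝ) × (Fin e → ℝ)) : ℝ :=
  Real.sqrt (∑ i, (P.1 i) ^ 2 + ∑ s, (P.2 s) ^ 2)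

/-- Closed Euclidean ball in `ℝ^d × ℝ^e`. -/
def cballE {d e : ℕ} (A : (Fin d → ℝ) × (Fin e → ℝ)) (r : ℝ) :
    Set ((Fin d → ℝ) × (Fin e → ℝ)) :=
  {B | enormP (B - A) ≤ r}

/-- `ψ` is a broad* solution of `(D₂^ψψ,…,D_m^ψψ) = w` in `𝒪`: around every point
there are exponential maps of the vector fields `D_j^ψ` along which `ψ(γ(t)) − ψ(γ(0))`
is the integral of `w_j ∘ γ`. -/
def IsBroadStar (m n : ℕ) (h0 : 0 < m) (b : Fin n → Matrix (Fin m) (Fin m) ℝ)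
    (O : Set (W m n 1)) (ψ : W m n 1 → ℝ) (w : W m n 1 → Fin (m - 1) → ℝ) : Prop :=
  ∀ A ∈ O, ∃ δ₁ δ₂ : ℝ, 0 < δ₂ ∧ δ₂ < δ₁ ∧ cballE A δ₁ ⊆ O ∧
    ∀ j : Fin (m - 1), ∃ γ : ℝ → W m n 1 → W m n 1,
      ∀ B ∈ cballE A δ₂,
        (∀ t ∈ Set.Icc (-δ₂) δ₂, γ t B ∈ cballE A δ₁) ∧
        γ 0 B = B ∧
        (∀ h : Fin (m - 1), ∀ t ∈ Set.Icc (-δ₂) δ₂,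
          HasDerivAt (fun t' => (γ t' B).1 h) (if h = j then 1 else 0) t) ∧
        (∀ s : Fin n, ∀ t ∈ Set.Icc (-δ₂) δ₂,
          HasDerivAt (fun t' => (γ t' B).2 s)
            (ψ (γ t B) * b s (idx1 m j) ⟨0, h0⟩ +
              (1 / 2) * ∑ l, (γ t B).1 l * b s (idx1 m j) (idx1 m l)) t) ∧
        (∀ t ∈ Set.Icc (-δ₂) δ₂, ψ (γ t B) - ψ B = ∫ r in (0:ℝ)..t, w (γ r B) j)

/-- The speed of the `y_s`-component along the vector field `D_j^ψ`, at a point with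
horizontal coordinates `x` where `ψ` takes the value `p`. -/
def ySpeed {m n : ℕ} (h0 : 0 < m) (b : Fin n → Matrix (Fin m) (Fin m) ℝ) (s : Fin n)
    (j : Fin (m - 1)) (p : ℝ) (x : Fin (m - 1) → ℝ) : ℝ :=
  p * b s (idx1 m j) ⟨0, h0⟩ + (1 / 2) * ∑ l, x l * b s (idx1 m j) (idx1 m l)

theorem norm_le_enorm {d : ℕ} (x : Fin d → ℝ) : ‖x‖ ≤ enorm x := by
  refine (pi_norm_le_iff_of_nonneg (Real.sqrt_nonneg _)).2 fun i => ?_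
  refine Real.abs_le_sqrt ?_
  exact Finset.single_le_sum (f := fun i => (x i) ^ 2) (fun i _ => sq_nonneg _) (Finset.mem_univ i)

theorem norm_le_enormP {d e : ℕ} (P : (Fin d → ℝ) × (Fin e → ℝ)) : ‖P‖ ≤ enormP P := by
  have h1 : 0 ≤ ∑ i, (P.1 i) ^ 2 := Finset.sum_nonneg fun i _ => sq_nonneg _
  have h2 : 0 ≤ ∑ i, (P.2 i) ^ 2 := Finset.sum_nonneg fun i _ => sq_nonneg _
  refine max_le ((norm_le_enorm P.1).trans ?_) ((norm_le_enorm P.2).trans ?_)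
  · exact Real.sqrt_le_sqrt (by linarith)
  · exact Real.sqrt_le_sqrt (by linarith)

theorem enormP_le {d e : ℕ} (P : (Fin d → ℝ) × (Fin e → ℝ)) :
    enormP P ≤ Real.sqrt (d + e) * ‖P‖ := by
  have h1 : ∑ i, (P.1 i) ^ 2 ≤ d * ‖P‖ ^ 2 := by
    have := Finset.sum_le_card_nsmul Finset.univ (fun i => (P.1 i) ^ 2) (‖P‖ ^ 2) fun i _ =>
      sq_le_sq.2 (by
        rw [abs_norm]; exact (norm_le_pi_norm P.1 i).trans (norm_fst_le P))
    simpa using this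
  have h2 : ∑ i, (P.2 i) ^ 2 ≤ e * ‖P‖ ^ 2 := by
    have := Finset.sum_le_card_nsmul Finset.univ (fun i => (P.2 i) ^ 2) (‖P‖ ^ 2) fun i _ =>
      sq_le_sq.2 (by
        rw [abs_norm]; exact (norm_le_pi_norm P.2 i).trans (norm_snd_le P))
    simpa using this
  rw [enormP, ← Real.sqrt_sq (norm_nonneg P), ← Real.sqrt_mul (by positivity)]
  exact Real.sqrt_le_sqrt (by linarith)

theorem isCompact_cballE {d e : ℕ} (A : (Fin d → ℝ) × (Fin e → ℝ)) (r : ℝ) :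
    IsCompact (cballE A r) := by
  refine Metric.isCompact_of_isClosed_isBounded ?_ ?_
  · have : Continuous fun B => enormP (B - A) := by unfold enormP; fun_prop
    exact isClosed_le this continuous_const
  · refine (Metric.isBounded_closedBall (x := A) (r := r)).subset fun B hB => ?_
    rw [mem_closedBall_iff_norm]
    exact (norm_le_enormP _).trans hB

theorem cballE_mem_nhds {d e : ℕ} (A : (Fin d → ℝ) × (Fin e → ℝ)) {r : ℝ} (hr : 0 < r) :
    cballE A r ∈ 𝓝 A := by
  have : Continuous fun B => enormP (B - A) := by unfold enormP; fun_prop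
  refine this.continuousAt.eventually_mem (s := Set.Iic r) (Iic_mem_nhds ?_)
  simpa [enormP] using hr

/-- The bilinear form of a skew-symmetric matrix, with the first variable split off. -/
theorem sum_skew_succ {d : ℕ} (M : Matrix (Fin (d + 1)) (Fin (d + 1)) ℝ)
    (hM : M.transpose = -M) (u v : Fin (d + 1) → ℝ) :
    ∑ i, ∑ j, M i j * u j * v i =
      ∑ i : Fin d, M i.succ 0 * (u 0 * v i.succ - v 0 * u i.succ) +
        ∑ i : Fin d, ∑ j : Fin d, M i.succ j.succ * u j.succ * v i.succ := by
  have hs : ∀ i j, M j i = -M i j := fun i j => congrFun (congrFun hM i) j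
  have h00 : M 0 0 = 0 := by linarith [hs 0 0]
  simp only [Fin.sum_univ_succ, h00, hs _ (0 : Fin (d + 1)), Finset.sum_add_distrib]
  simp only [mul_sub, Finset.sum_sub_distrib, neg_mul, Finset.sum_neg_distrib, mul_assoc,
    mul_comm (v 0)]
  ring

theorem sum_skew_self {d : ℕ} (M : Matrix (Fin (d + 1)) (Fin (d + 1)) ℝ)
    (hM : M.transpose = -M) (u : Fin d → ℝ) :
    ∑ i : Fin d, ∑ j : Fin d, M i.succ j.succ * u j * u i = 0 := by
  have hs : ∀ i j, M j i = -M i j := fun i j => congrFun (congrFun hM i) j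
  have h : ∑ i : Fin d, ∑ j : Fin d, M i.succ j.succ * u j * u i =
      -∑ i : Fin d, ∑ j : Fin d, M i.succ j.succ * u j * u i := by
    conv_lhs => rw [Finset.sum_comm]
    simp only [← Finset.sum_neg_distrib]
    refine Finset.sum_congr rfl fun i _ => Finset.sum_congr rfl fun j _ => ?_
    rw [hs i.succ j.succ]; ring
  linarith

/-- The vertical part of `ψ̂(A)⁻¹·i(A)⁻¹·i(B)·ψ̂(A)` when `ψ(A) = p`. -/
def yDefect {m n : ℕ} (h0 : 0 < m) (b : Fin n → Matrix (Fin m) (Fin m) ℝ) (p : ℝ)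
    (A B : W m n 1) (s : Fin n) : ℝ :=
  B.2 s - A.2 s - ∑ j, ySpeed h0 b s j p A.1 * (B.1 j - A.1 j)

theorem norm_add_sqrt_le_sigma {m n : ℕ} (h0 : 0 < m) (b : Fin n → Matrix (Fin m) (Fin m) ℝ)
    (hskew : ∀ s, (b s).transpose = -(b s)) (ψ : W m n 1 → ℝ) (A B : W m n 1) :
    ‖B.1 - A.1‖ + Real.sqrt ‖yDefect h0 b (ψ A) A B‖ ≤
      sigma m n 1 b (fun A' _ => ψ A') A B := by
  obtain ⟨d, rfl⟩ : ∃ d, m = d + 1 := ⟨m - 1, by omega⟩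
  unfold sigma qnorm
  refine add_le_add ?_ ?_
  · refine le_trans ?_ (norm_le_enorm _)
    refine (pi_norm_le_iff_of_nonneg (norm_nonneg _)).2 fun i => ?_
    refine le_trans (le_of_eq ?_) (norm_le_pi_norm _ (Fin.succ i))
    simp [gmul, ginv, embW, embH]
    congr 1
    ring
  · refine Real.sqrt_le_sqrt ((norm_le_enorm _).trans (le_of_eq ?_))
    congr 1
    funext s
    have hq := sum_skew_self (b s) (hskew s) A.1
    simp only [yDefect, ySpeed, gmul, ginv, sum_skew_succ (b s) (hskew s)]
    simp only [embW, embH, Pi.add_apply, Pi.neg_apply, Pi.zero_apply, Fin.val_succ, Fin.val_zero]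
    have hi : ∀ x, idx1 (d + 1) x = x.succ := fun _ => rfl
    have h1 : ∑ x : Fin d, (ψ A * b s x.succ 0 + 2⁻¹ * ∑ l, A.1 l * b s x.succ l.succ) *
        (B.1 x - A.1 x) =
        ∑ x : Fin d, b s x.succ 0 * (ψ A * B.1 x) - ∑ x : Fin d, b s x.succ 0 * (ψ A * A.1 x) +
          2⁻¹ * (∑ x : Fin d, ∑ l : Fin d, b s x.succ l.succ * A.1 l * B.1 x -
            ∑ x : Fin d, ∑ l : Fin d, b s x.succ l.succ * A.1 l * A.1 x) := by
      simp only [← Finset.sum_sub_distrib, Finset.mul_sum, ← Finset.sum_add_distrib, add_mul,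
        Finset.sum_mul]
      refine Finset.sum_congr rfl fun x _ => congrArg₂ _ (by ring) ?_
      exact Finset.sum_congr rfl fun l _ => by ring
    have h2 : ∑ x : Fin d, b s x.succ 0 * (ψ A * (-A.1 x + B.1 x)) =
        ∑ x : Fin d, b s x.succ 0 * (ψ A * B.1 x) -
          ∑ x : Fin d, b s x.succ 0 * (ψ A * A.1 x) := by
      rw [← Finset.sum_sub_distrib]
      exact Finset.sum_congr rfl fun x _ => by ring
    simp [hi]
    refine (congrArg (fun z => B.2 s - A.2 s - z) h1).trans ?_
    linarith

theorem dW_eq_sigma_zero {m n k : ℕ} (b : Fin n → Matrix (Fin m) (Fin m) ℝ) (A B : W m n k) :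
    dW m n k b A B = sigma m n k b (fun _ _ => 0) A B := by
  have h : embH m n k (fun _ => 0) = 0 := by
    ext i <;> simp [embH]
  simp [dW, sigma, h, gmul, ginv]

theorem exists_ySpeed_lipschitz {m n : ℕ} (h0 : 0 < m) (b : Fin n → Matrix (Fin m) (Fin m) ℝ) :
    ∃ L : ℝ, 0 ≤ L ∧ ∀ s j p x p' x',
      |ySpeed h0 b s j p x - ySpeed h0 b s j p' x'| ≤ L * (|p - p'| + ‖x - x'‖) := by
  obtain ⟨M, hM⟩ := Finite.exists_le fun i : Fin n × Fin m × Fin m => |b i.1 i.2.1 i.2.2|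
  replace hM : ∀ s i j, |b s i j| ≤ |M| := fun s i j => (hM (s, i, j)).trans (le_abs_self M)
  refine ⟨|M| * (1 + (m - 1 : ℕ)), by positivity, fun s j p x p' x' => ?_⟩
  have h1 : ySpeed h0 b s j p x - ySpeed h0 b s j p' x' =
      (p - p') * b s (idx1 m j) ⟨0, h0⟩ +
        (1 / 2) * ∑ l, (x - x') l * b s (idx1 m j) (idx1 m l) := by
    simp only [ySpeed, Pi.sub_apply, sub_mul, Finset.sum_sub_distrib]
    ring
  have h2 : |∑ l, (x - x') l * b s (idx1 m j) (idx1 m l)| ≤ (m - 1 : ℕ) * (‖x - x'‖ * |M|) := by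
    refine (Finset.abs_sum_le_sum_abs _ _).trans ?_
    have := Finset.sum_le_card_nsmul Finset.univ
      (fun l => |(x - x') l * b s (idx1 m j) (idx1 m l)|) (‖x - x'‖ * |M|) fun l _ => by
        rw [abs_mul]
        exact mul_le_mul (norm_le_pi_norm (x - x') l) (hM _ _ _) (abs_nonneg _) (norm_nonneg _)
    simpa using this
  have h3 : |(p - p') * b s (idx1 m j) ⟨0, h0⟩| ≤ |p - p'| * |M| := by
    rw [abs_mul]
    exact mul_le_mul_of_nonneg_left (hM _ _ _) (abs_nonneg _)
  have h4 : 0 ≤ |p - p'| * |M| := by positivity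
  have h5 : 0 ≤ ‖x - x'‖ * |M| := by positivity
  have h6 : (0 : ℝ) ≤ (m - 1 : ℕ) * (‖x - x'‖ * |M|) := by positivity
  have h7 : (0 : ℝ) ≤ (m - 1 : ℕ) * (|p - p'| * |M|) := by positivity
  rw [h1]
  refine (abs_add_le _ _).trans ?_
  rw [abs_mul (1 / 2 : ℝ), abs_of_pos (one_half_pos (α := ℝ))]
  linarith

/-- Following one exponential curve of a broad* solution for a short time. -/
theorem IsBroadStar.exists_step {m n : ℕ} {h0 : 0 < m} {b : Fin n → Matrix (Fin m) (Fin m) ℝ}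
    {O : Set (W m n 1)} {ψ : W m n 1 → ℝ} {w : W m n 1 → Fin (m - 1) → ℝ}
    (hbroad : IsBroadStar m n h0 b O ψ w) (hO : IsOpen O) (hψ : ContinuousOn ψ O)
    (hw : ContinuousOn w O) {A₀ : W m n 1} (hA₀ : A₀ ∈ O) {ε : ℝ} (hε : 0 < ε)
    (j : Fin (m - 1)) :
    ∃ C : ℝ, 0 ≤ C ∧ ∃ ρ > 0, ∀ A, ‖A - A₀‖ ≤ ρ → ∀ t, |t| ≤ ρ → ∃ A' : W m n 1,
      A'.1 = A.1 + Pi.single j t ∧ ‖A' - A‖ ≤ C * |t| ∧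
      (∀ s, |A'.2 s - A.2 s - ySpeed h0 b s j (ψ A) A.1 * t| ≤ C * |t| ^ 2) ∧
      |ψ A' - ψ A - w A₀ j * t| ≤ ε * |t| := by
  obtain ⟨δ₁, δ₂, hδ₂, -, hsub, hγ⟩ := hbroad A₀ hA₀
  obtain ⟨γ, hγ⟩ := hγ j
  obtain ⟨L, hL, hLip⟩ := exists_ySpeed_lipschitz h0 b
  have hK := isCompact_cballE A₀ δ₁
  obtain ⟨V₁, hV₁⟩ := hK.exists_bound_of_continuousOn (hψ.mono hsub)
  obtain ⟨V₂, hV₂⟩ := hK.exists_bound_of_continuousOn (f := fun P => P) continuousOn_id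
  set V := L * (|V₁| + |V₂|) + 1
  have hV1 : 1 ≤ V := by
    have : 0 ≤ L * (|V₁| + |V₂|) := by positivity
    linarith
  have hV : ∀ P ∈ cballE A₀ δ₁, ∀ s, |ySpeed h0 b s j (ψ P) P.1| ≤ V := fun P hP s => by
    have h := hLip s j (ψ P) P.1 0 0
    have h' : ySpeed h0 b s j 0 0 = 0 := by simp [ySpeed]
    rw [h', sub_zero, sub_zero, sub_zero] at h
    have h1 : |ψ P| ≤ |V₁| := (hV₁ P hP).trans (le_abs_self _)
    have h2 : ‖P.1‖ ≤ |V₂| := (norm_fst_le P).trans ((hV₂ P hP).trans (le_abs_self _))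
    have := mul_le_mul_of_nonneg_left (add_le_add h1 h2) hL
    linarith
  have hwA : ∀ᶠ P in 𝓝 A₀, ‖w P - w A₀‖ < ε := by
    have := (hw.continuousAt (hO.mem_nhds hA₀)).eventually (Metric.ball_mem_nhds (w A₀) hε)
    simpa [dist_eq_norm] using this
  obtain ⟨η, hη, hball⟩ := Metric.eventually_nhds_iff.1 (hwA.and (cballE_mem_nhds A₀ hδ₂))
  have hVpos : 0 < V := by linarith
  set Q := ‖w A₀‖ + ε
  have hQ : 0 ≤ Q := by positivity
  refine ⟨V + L * (Q + 1), by positivity, min δ₂ (η / (4 * V)), by positivity,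
    fun A hA T hT => ?_⟩
  have hρη : min δ₂ (η / (4 * V)) * V ≤ η / 4 := by
    calc min δ₂ (η / (4 * V)) * V ≤ η / (4 * V) * V := by gcongr; exact min_le_right _ _
      _ = η / 4 := by field_simp
  have hρη' : min δ₂ (η / (4 * V)) ≤ η / 4 := by
    refine le_trans ?_ hρη
    exact le_mul_of_one_le_right (by positivity) hV1
  have hAball : dist A A₀ < η := by rw [dist_eq_norm]; linarith
  obtain ⟨hmem, hzero, hx, hy, hint⟩ := hγ A (hball hAball).2
  have hTδ : ∀ t ∈ uIcc 0 T, t ∈ Icc (-δ₂) δ₂ ∧ |t| ≤ |T| := fun t ht => by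
    have h1 : |t| ≤ |T| := by simpa using abs_sub_left_of_mem_uIcc ht
    exact ⟨abs_le.1 (h1.trans (hT.trans (min_le_left _ _))), h1⟩
  have hmv : ∀ {f f' : ℝ → ℝ} {c : ℝ}, (∀ t ∈ Icc (-δ₂) δ₂, HasDerivAt f (f' t) t) →
      ∀ t ∈ uIcc 0 T, (∀ r ∈ uIcc 0 t, |f' r| ≤ c) → |f t - f 0| ≤ c * |t| := by
    intro f f' c hf t ht hc
    have hs : ∀ r ∈ uIcc 0 t, r ∈ uIcc 0 T := fun r hr => uIcc_subset_uIcc_left ht hr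
    have := (convex_uIcc 0 t).norm_image_sub_le_of_norm_hasDerivWithin_le
      (fun r hr => (hf r (hTδ r (hs r hr)).1).hasDerivWithinAt) hc left_mem_uIcc right_mem_uIcc
    simpa using this
  have hx' : ∀ t ∈ uIcc 0 T, (γ t A).1 = A.1 + Pi.single j t := by
    intro t ht
    ext h
    have hd : ∀ r ∈ Icc (-δ₂) δ₂,
        HasDerivAt (fun r => (γ r A).1 h - (if h = j then 1 else 0) * r) 0 r := fun r hr =>
      ((hx h r hr).sub ((hasDerivAt_id r).const_mul (if h = j then (1 : ℝ) else 0))).congr_deriv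
        (by simp)
    have := hmv hd t ht (c := 0) (by simp)
    simp only [zero_mul, abs_nonpos_iff, hzero, mul_zero] at this
    simp only [Pi.add_apply, Pi.single_apply]
    split_ifs at this ⊢ <;> linarith
  have hy' : ∀ t ∈ uIcc 0 T, ∀ s, |(γ t A).2 s - A.2 s| ≤ V * |t| := by
    intro t ht s
    have := hmv (hy s) t ht (c := V) fun r hr =>
      hV _ (hmem r (hTδ r (uIcc_subset_uIcc_left ht hr)).1) s
    simpa [hzero] using this
  have hxnorm : ∀ t ∈ uIcc 0 T, ‖(γ t A).1 - A.1‖ ≤ |t| := fun t ht => by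
    rw [hx' t ht, add_sub_cancel_left, Pi.norm_single, Real.norm_eq_abs]
  have hnorm : ∀ t ∈ uIcc 0 T, ‖γ t A - A‖ ≤ V * |t| := by
    intro t ht
    refine max_le ((hxnorm t ht).trans ?_) ?_
    · exact le_mul_of_one_le_left (abs_nonneg _) hV1
    · exact (pi_norm_le_iff_of_nonneg (by positivity)).2 fun s => hy' t ht s
  have hwγ : ∀ t ∈ uIcc 0 T, ‖w (γ t A) - w A₀‖ < ε := by
    intro t ht
    refine (hball ?_).1
    rw [dist_eq_norm]
    have h1 : ‖γ t A - A₀‖ ≤ ‖γ t A - A‖ + ‖A - A₀‖ := norm_sub_le_norm_sub_add_norm_sub _ _ _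
    have h2 : V * |t| ≤ V * min δ₂ (η / (4 * V)) :=
      mul_le_mul_of_nonneg_left ((hTδ t ht).2.trans hT) hVpos.le
    linarith [hnorm t ht]
  have hcont : ContinuousOn (fun t => w (γ t A) j) (uIcc 0 T) := by
    have hγc : ContinuousOn (fun t => γ t A) (uIcc 0 T) := by
      refine ContinuousOn.prodMk (f := fun t => (γ t A).1) (g := fun t => (γ t A).2)
        (continuousOn_pi.2 fun h t ht => ?_) (continuousOn_pi.2 fun s t ht => ?_)
      · exact (hx h t (hTδ t ht).1).continuousAt.continuousWithinAt
      · exact (hy s t (hTδ t ht).1).continuousAt.continuousWithinAt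
    have := hw.comp hγc fun t ht => hsub (hmem t (hTδ t ht).1)
    exact continuousOn_pi.1 this j
  have hψ' : ∀ t ∈ uIcc 0 T, |ψ (γ t A) - ψ A - w A₀ j * t| ≤ ε * |t| := by
    intro t ht
    have hi : IntervalIntegrable (fun r => w (γ r A) j) volume 0 t :=
      (hcont.mono (uIcc_subset_uIcc_left ht)).intervalIntegrable
    have h1 : ψ (γ t A) - ψ A - w A₀ j * t = ∫ r in (0 : ℝ)..t, (w (γ r A) j - w A₀ j) := by
      rw [intervalIntegral.integral_sub hi intervalIntegrable_const, hint t (hTδ t ht).1]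
      simp [mul_comm]
    rw [h1]
    have := intervalIntegral.norm_integral_le_of_norm_le_const (a := 0) (b := t) (C := ε)
      (f := fun r => w (γ r A) j - w A₀ j) fun r hr =>
        (norm_le_pi_norm (w (γ r A) - w A₀) j).trans
          (hwγ r (uIcc_subset_uIcc_left ht (uIoc_subset_uIcc hr))).le
    simpa using this
  have hψ'' : ∀ t ∈ uIcc 0 T, |ψ (γ t A) - ψ A| ≤ Q * |t| := by
    intro t ht
    have h1 : |w A₀ j * t| ≤ ‖w A₀‖ * |t| := by
      rw [abs_mul]
      exact mul_le_mul_of_nonneg_right (norm_le_pi_norm (w A₀) j) (abs_nonneg _)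
    have h2 : |ψ (γ t A) - ψ A| ≤ |ψ (γ t A) - ψ A - w A₀ j * t| + |w A₀ j * t| := by
      simpa using abs_add_le (ψ (γ t A) - ψ A - w A₀ j * t) (w A₀ j * t)
    have h3 : Q * |t| = ‖w A₀‖ * |t| + ε * |t| := add_mul _ _ _
    linarith [hψ' t ht]
  refine ⟨γ T A, hx' T right_mem_uIcc, ?_, fun s => ?_, hψ' T right_mem_uIcc⟩
  · refine (hnorm T right_mem_uIcc).trans (mul_le_mul_of_nonneg_right ?_ (abs_nonneg _))
    have : 0 ≤ L * (Q + 1) := by positivity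
    linarith
  · have hd : ∀ r ∈ Icc (-δ₂) δ₂,
        HasDerivAt (fun r => (γ r A).2 s - ySpeed h0 b s j (ψ A) A.1 * r)
          (ySpeed h0 b s j (ψ (γ r A)) (γ r A).1 - ySpeed h0 b s j (ψ A) A.1) r := fun r hr =>
      ((hy s r hr).sub ((hasDerivAt_id r).const_mul (ySpeed h0 b s j (ψ A) A.1))).congr_deriv
        (by simp [ySpeed])
    have := hmv hd T right_mem_uIcc (c := L * (Q + 1) * |T|) fun r hr => by
      refine (hLip s j _ _ _ _).trans ?_
      rw [mul_assoc]
      refine mul_le_mul_of_nonneg_left ?_ hL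
      have h1 := hψ'' r hr
      have h2 := hxnorm r hr
      have h3 := mul_le_mul_of_nonneg_left (hTδ r hr).2 (add_nonneg hQ zero_le_one)
      linarith
    simp only [hzero, mul_zero, sub_zero] at this
    have h1 : 0 ≤ V * |T| ^ 2 := by positivity
    rw [sub_right_comm]
    linarith

/-- Following successively the exponential curves in the directions of a finite set. -/
theorem IsBroadStar.exists_path {m n : ℕ} {h0 : 0 < m} {b : Fin n → Matrix (Fin m) (Fin m) ℝ}
    {O : Set (W m n 1)} {ψ : W m n 1 → ℝ} {w : W m n 1 → Fin (m - 1) → ℝ}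
    (hbroad : IsBroadStar m n h0 b O ψ w) (hO : IsOpen O) (hψ : ContinuousOn ψ O)
    (hw : ContinuousOn w O) {A₀ : W m n 1} (hA₀ : A₀ ∈ O) {ε : ℝ} (hε : 0 < ε)
    (S : Finset (Fin (m - 1))) :
    ∃ C : ℝ, 0 ≤ C ∧ ∃ ρ > 0, ∀ A, ‖A - A₀‖ ≤ ρ → ∀ v : Fin (m - 1) → ℝ, ‖v‖ ≤ ρ →
      ∃ A' : W m n 1,
        A'.1 = A.1 + ∑ j ∈ S, Pi.single j (v j) ∧ ‖A' - A‖ ≤ C * ‖v‖ ∧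
        (∀ s, |A'.2 s - A.2 s - ∑ j ∈ S, ySpeed h0 b s j (ψ A) A.1 * v j| ≤ C * ‖v‖ ^ 2) ∧
        |ψ A' - ψ A - ∑ j ∈ S, w A₀ j * v j| ≤ ε * S.card * ‖v‖ := by
  classical
  induction S using Finset.induction_on with
  | empty => exact ⟨0, le_rfl, 1, one_pos, fun A _ v _ => ⟨A, by simp⟩⟩
  | insert a S ha ih =>
    obtain ⟨C₁, hC₁, ρ₁, hρ₁, h₁⟩ := ih
    obtain ⟨C₂, hC₂, ρ₂, hρ₂, h₂⟩ := hbroad.exists_step hO hψ hw hA₀ hε a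
    obtain ⟨L, hL, hLip⟩ := exists_ySpeed_lipschitz h0 b
    set Q := ε * S.card + ∑ j ∈ S, |w A₀ j|
    have hQ : 0 ≤ Q := by positivity
    refine ⟨C₁ + C₂ + L * (Q + C₁), by positivity, min ρ₁ (ρ₂ / (1 + C₁)), by positivity,
      fun A hA v hv => ?_⟩
    obtain ⟨B, hB1, hBn, hB2, hBψ⟩ :=
      h₁ A (hA.trans (min_le_left _ _)) v (hv.trans (min_le_left _ _))
    have hρ : (1 + C₁) * min ρ₁ (ρ₂ / (1 + C₁)) ≤ ρ₂ := by
      calc _ ≤ (1 + C₁) * (ρ₂ / (1 + C₁)) := by gcongr; exact min_le_right _ _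
        _ = ρ₂ := by field_simp
    have hva : |v a| ≤ ‖v‖ := norm_le_pi_norm v a
    have hBA₀ : ‖B - A₀‖ ≤ ρ₂ := by
      have h1 : ‖B - A₀‖ ≤ ‖B - A‖ + ‖A - A₀‖ := norm_sub_le_norm_sub_add_norm_sub _ _ _
      have h2 := mul_le_mul_of_nonneg_left hv hC₁
      linarith
    have hvρ : |v a| ≤ ρ₂ := by
      have h2 : 0 ≤ C₁ * min ρ₁ (ρ₂ / (1 + C₁)) := by positivity
      linarith
    obtain ⟨A', hA'1, hA'n, hA'2, hA'ψ⟩ := h₂ B hBA₀ (v a) hvρ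
    have hBψ' : |ψ B - ψ A| ≤ Q * ‖v‖ := by
      have h1 : |∑ j ∈ S, w A₀ j * v j| ≤ (∑ j ∈ S, |w A₀ j|) * ‖v‖ := by
        rw [Finset.sum_mul]
        refine (Finset.abs_sum_le_sum_abs _ _).trans (Finset.sum_le_sum fun j _ => ?_)
        rw [abs_mul]
        exact mul_le_mul_of_nonneg_left (norm_le_pi_norm v j) (abs_nonneg _)
      have h2 : |ψ B - ψ A| ≤ |ψ B - ψ A - ∑ j ∈ S, w A₀ j * v j| + |∑ j ∈ S, w A₀ j * v j| := by
        simpa using abs_add_le (ψ B - ψ A - ∑ j ∈ S, w A₀ j * v j) (∑ j ∈ S, w A₀ j * v j)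
      rw [add_mul]
      linarith
    have hC₂v := mul_le_mul_of_nonneg_left hva hC₂
    refine ⟨A', ?_, ?_, fun s => ?_, ?_⟩
    · rw [hA'1, hB1, Finset.sum_insert ha]
      abel
    · have h1 : ‖A' - A‖ ≤ ‖A' - B‖ + ‖B - A‖ := norm_sub_le_norm_sub_add_norm_sub _ _ _
      have h2 : 0 ≤ L * (Q + C₁) * ‖v‖ := by positivity
      linarith
    · rw [Finset.sum_insert ha]
      have h1 : |(ySpeed h0 b s a (ψ B) B.1 - ySpeed h0 b s a (ψ A) A.1) * v a| ≤
          L * (Q + C₁) * ‖v‖ ^ 2 := by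
        rw [abs_mul]
        calc _ ≤ L * (Q * ‖v‖ + C₁ * ‖v‖) * ‖v‖ := by
              refine mul_le_mul ((hLip _ _ _ _ _ _).trans ?_) hva (abs_nonneg _) (by positivity)
              exact mul_le_mul_of_nonneg_left
                (add_le_add hBψ' ((norm_fst_le (B - A)).trans hBn)) hL
          _ = _ := by ring
      have h2 : C₂ * |v a| ^ 2 ≤ C₂ * ‖v‖ ^ 2 := by gcongr
      have h3 := hA'2 s
      have h4 := hB2 s
      calc _ = |(A'.2 s - B.2 s - ySpeed h0 b s a (ψ B) B.1 * v a) +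
            (B.2 s - A.2 s - ∑ j ∈ S, ySpeed h0 b s j (ψ A) A.1 * v j) +
            (ySpeed h0 b s a (ψ B) B.1 - ySpeed h0 b s a (ψ A) A.1) * v a| := by
              congr 1; ring
        _ ≤ _ := (abs_add_three _ _ _).trans (by linarith)
    · rw [Finset.sum_insert ha, Finset.card_insert_of_notMem ha]
      have h2 := mul_le_mul_of_nonneg_left hva hε.le
      push_cast
      calc _ = |(ψ A' - ψ B - w A₀ a * v a) + (ψ B - ψ A - ∑ j ∈ S, w A₀ j * v j)| := by
              congr 1; ring
        _ ≤ _ := (abs_add_le _ _).trans (by linarith)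

/-- On bounded sets the product norm is controlled by the homogeneous distance at small scale. -/
theorem exists_norm_sub_le_mul_dW {m n : ℕ} (h0 : 0 < m) (b : Fin n → Matrix (Fin m) (Fin m) ℝ)
    (hskew : ∀ s, (b s).transpose = -(b s)) (R : ℝ) :
    ∃ C : ℝ, 0 ≤ C ∧ ∀ A B : W m n 1, ‖A‖ ≤ R → dW m n 1 b A B ≤ 1 →
      ‖B - A‖ ≤ C * dW m n 1 b A B := by
  obtain ⟨L, hL, hLip⟩ := exists_ySpeed_lipschitz h0 b
  refine ⟨1 + (m - 1 : ℕ) * (L * |R|), by positivity, fun A B hA hAB => ?_⟩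
  have h := norm_add_sqrt_le_sigma h0 b hskew (fun _ => 0) A B
  rw [dW_eq_sigma_zero] at hAB ⊢
  set σ := sigma m n 1 b (fun _ _ => 0) A B
  have hx : ‖B.1 - A.1‖ ≤ σ := by linarith [Real.sqrt_nonneg ‖yDefect h0 b 0 A B‖]
  have hσ : 0 ≤ σ := (norm_nonneg _).trans hx
  have hy : ‖yDefect h0 b 0 A B‖ ≤ σ := by
    have h1 : Real.sqrt ‖yDefect h0 b 0 A B‖ ≤ σ := by linarith [norm_nonneg (B.1 - A.1)]
    have h2 := (Real.sqrt_le_left hσ).1 h1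
    nlinarith
  have hP : 0 ≤ (m - 1 : ℕ) * (L * |R|) * σ := by positivity
  refine max_le (hx.trans (by linarith)) ?_
  refine (pi_norm_le_iff_of_nonneg (by positivity)).2 fun s => ?_
  have h1 : |∑ j, ySpeed h0 b s j 0 A.1 * (B.1 j - A.1 j)| ≤ (m - 1 : ℕ) * (L * |R| * σ) := by
    refine (Finset.abs_sum_le_sum_abs _ _).trans ?_
    have := Finset.sum_le_card_nsmul Finset.univ
      (fun j => |ySpeed h0 b s j 0 A.1 * (B.1 j - A.1 j)|) (L * |R| * σ) fun j _ => by
        rw [abs_mul]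
        refine mul_le_mul ?_ ((norm_le_pi_norm (B.1 - A.1) j).trans hx) (abs_nonneg _)
          (by positivity)
        have h2 := hLip s j 0 A.1 0 0
        have h' : ySpeed h0 b s j 0 0 = 0 := by simp [ySpeed]
        rw [h', sub_zero, sub_zero, sub_zero, abs_zero, zero_add] at h2
        exact h2.trans (mul_le_mul_of_nonneg_left
          ((norm_fst_le A).trans (hA.trans (le_abs_self R))) hL)
    simpa using this
  have h3 : |yDefect h0 b 0 A B s| ≤ σ := (norm_le_pi_norm _ s).trans hy
  have h4 : (B - A).2 s = yDefect h0 b 0 A B s + ∑ j, ySpeed h0 b s j 0 A.1 * (B.1 j - A.1 j) := by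
    simp [yDefect]
  rw [h4, Real.norm_eq_abs]
  exact (abs_add_le _ _).trans (by linarith)

/-- If `ψ ∈ C(𝒪)` is a broad* solution of
`(D₂^ψψ,…,D_m^ψψ) = w` with `w` continuous, and `ψ ∈ h^{1/2}_loc(𝒪)`, then `ψ`
is uniformly intrinsically differentiable at every point of `𝒪` and its intrinsic
gradient is `w`. -/
theorem statement15 (m n : ℕ) (hm : 2 ≤ m) (hn : 1 ≤ n)
    (b : Fin n → Matrix (Fin m) (Fin m) ℝ)
    (hskew : ∀ s, (b s).transpose = -(b s)) (hind : LinearIndependent ℝ b)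
    (O : Set (W m n 1)) (hO : IsOpen O)
    (ψ : W m n 1 → ℝ) (hψ : ContinuousOn ψ O)
    (w : W m n 1 → Fin (m - 1) → ℝ) (hw : ContinuousOn w O)
    (hbroad : IsBroadStar m n (by omega) b O ψ w)
    (hhold : ∀ K ⊆ O, IsCompact K → ∀ ε > 0, ∃ r > 0, ∀ A ∈ K, ∀ A' ∈ K,
      0 < enormP (A - A') → enormP (A - A') ≤ r →
      |ψ A - ψ A'| ≤ ε * Real.sqrt (enormP (A - A'))) :
    ∀ A ∈ O, UIDs m n b O ψ A (w A) := by
  intro A₀ hA₀ ε hε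
  have h0 : 0 < m := by omega
  obtain ⟨C, hC, ρ, hρ, hpath⟩ := hbroad.exists_path hO hψ hw hA₀
    (ε := ε / (2 * ((m - 1 : ℕ) + 1))) (by positivity) Finset.univ
  obtain ⟨η, hη, hηO⟩ := Metric.nhds_basis_closedBall.mem_iff.1 (hO.mem_nhds hA₀)
  set D := Real.sqrt ((m - 1 : ℕ) + n)
  set E := Real.sqrt (D * (1 + C))
  have hD : D + 1 ≠ 0 := by positivity
  have hE : E + 1 ≠ 0 := by positivity
  obtain ⟨r, hr, hhold⟩ := hhold _ hηO (isCompact_closedBall A₀ η) (ε / (2 * (E + 1)))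
    (by positivity)
  obtain ⟨M, hM, hdW⟩ := exists_norm_sub_le_mul_dW h0 b hskew (‖A₀‖ + 1)
  obtain ⟨κ, hκ, hκ1, hκρ, hκη, hκr⟩ : ∃ κ > 0, κ ≤ 1 ∧ κ ≤ ρ ∧ (2 + C) * κ ≤ η ∧
      D * ((1 + C) * κ) ≤ r := by
    refine ⟨min (min 1 ρ) (min (η / (2 + C)) (r / ((D + 1) * (1 + C)))), by positivity,
      ?_, ?_, ?_, ?_⟩
    · exact (min_le_left _ _).trans (min_le_left _ _)
    · exact (min_le_left _ _).trans (min_le_right _ _)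
    · calc _ ≤ (2 + C) * (η / (2 + C)) := by
            gcongr; exact (min_le_right _ _).trans (min_le_left _ _)
        _ = η := by field_simp
    · calc _ ≤ (D + 1) * ((1 + C) * (r / ((D + 1) * (1 + C)))) := by
            gcongr
            · linarith
            · exact (min_le_right _ _).trans (min_le_right _ _)
        _ = r := by field_simp
  refine ⟨min 1 (κ / (M + 1)), by positivity, fun A _ B _ hA hB _ => ?_⟩
  have hclose : ∀ P Q : W m n 1, ‖P‖ ≤ ‖A₀‖ + 1 → dW m n 1 b P Q < min 1 (κ / (M + 1)) →
      ‖Q - P‖ ≤ κ := fun P Q hP hPQ => by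
    refine (hdW P Q hP (hPQ.le.trans (min_le_left _ _))).trans ?_
    calc _ ≤ (M + 1) * (κ / (M + 1)) := by
          have h1 := hPQ.le.trans (min_le_right _ _)
          have h2 : 0 ≤ κ / (M + 1) := by positivity
          have h3 := mul_le_mul_of_nonneg_left h1 hM
          linarith
      _ = κ := by field_simp
  have hAκ : ‖A - A₀‖ ≤ κ := hclose A₀ A (by linarith) hA
  have hBκ : ‖B - A‖ ≤ κ := by
    refine hclose A B ?_ hB
    have := norm_add_le A₀ (A - A₀)
    rw [add_sub_cancel] at this
    linarith
  have hv : ‖B.1 - A.1‖ ≤ κ := (norm_fst_le (B - A)).trans hBκ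
  obtain ⟨P, hP1, hPn, hP2, hPψ⟩ := hpath A (hAκ.trans hκρ) (B.1 - A.1) (hv.trans hκρ)
  have hPB : P.1 = B.1 := by rw [hP1, Finset.univ_sum_single]; abel
  have hσ := norm_add_sqrt_le_sigma h0 b hskew ψ A B
  set σ := sigma m n 1 b (fun A' _ => ψ A') A B
  have hxσ : ‖B.1 - A.1‖ ≤ σ := by linarith [Real.sqrt_nonneg ‖yDefect h0 b (ψ A) A B‖]
  have hσ0 : 0 ≤ σ := (norm_nonneg _).trans hxσ
  have hyσ : ‖yDefect h0 b (ψ A) A B‖ ≤ σ ^ 2 :=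
    (Real.sqrt_le_left hσ0).1 (by linarith [norm_nonneg (B.1 - A.1)])
  have hBP : ‖B - P‖ ≤ (1 + C) * σ ^ 2 := by
    refine max_le ?_ ((pi_norm_le_iff_of_nonneg (by positivity)).2 fun s => ?_)
    · have : (B - P).1 = 0 := by simp [hPB]
      rw [this, norm_zero]; positivity
    · have h1 := (norm_le_pi_norm _ s).trans hyσ
      have h2 := hP2 s
      have h3 : C * ‖B.1 - A.1‖ ^ 2 ≤ C * σ ^ 2 := by gcongr
      have h4 : (B - P).2 s = yDefect h0 b (ψ A) A B s -
          (P.2 s - A.2 s - ∑ j, ySpeed h0 b s j (ψ A) A.1 * (B.1 - A.1) j) := by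
        simp [yDefect]
      rw [h4]
      refine (norm_sub_le _ _).trans ?_
      rw [Real.norm_eq_abs (_ - _)]
      linarith
  have hCv := mul_le_mul_of_nonneg_left hv hC
  have hAη : ‖B - A₀‖ ≤ η ∧ ‖P - A₀‖ ≤ η := by
    have h1 : ‖B - A₀‖ ≤ ‖B - A‖ + ‖A - A₀‖ := norm_sub_le_norm_sub_add_norm_sub _ _ _
    have h2 : ‖P - A₀‖ ≤ ‖P - A‖ + ‖A - A₀‖ := norm_sub_le_norm_sub_add_norm_sub _ _ _
    have h3 : 0 ≤ C * κ := by positivity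
    exact ⟨by linarith, by linarith⟩
  have hψBP : |ψ B - ψ P| ≤ ε / 2 * σ := by
    rcases eq_or_ne B P with rfl | hne
    · rw [sub_self, abs_zero]; positivity
    have hpos : 0 < enormP (B - P) :=
      (norm_pos_iff.2 (sub_ne_zero.2 hne)).trans_le (norm_le_enormP _)
    have hle : enormP (B - P) ≤ r := by
      refine (enormP_le _).trans (le_trans ?_ hκr)
      refine mul_le_mul_of_nonneg_left ?_ (Real.sqrt_nonneg _)
      have h1 : ‖B - P‖ ≤ ‖B - A‖ + ‖A - P‖ := norm_sub_le_norm_sub_add_norm_sub _ _ _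
      rw [norm_sub_rev A P] at h1
      linarith
    refine (hhold B (mem_closedBall_iff_norm.2 hAη.1) P (mem_closedBall_iff_norm.2 hAη.2)
      hpos hle).trans ?_
    have hsq : Real.sqrt (enormP (B - P)) ≤ E * σ := by
      rw [← Real.sqrt_sq hσ0, ← Real.sqrt_mul (by positivity)]
      refine Real.sqrt_le_sqrt ((enormP_le _).trans ?_)
      rw [mul_assoc]
      exact mul_le_mul_of_nonneg_left hBP (Real.sqrt_nonneg _)
    calc _ ≤ ε / (2 * (E + 1)) * ((E + 1) * σ) := by
          refine mul_le_mul_of_nonneg_left (hsq.trans ?_) (by positivity)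
          linarith
      _ = ε / 2 * σ := by field_simp
  have hψPA : |ψ P - ψ A - ∑ j, w A₀ j * (B.1 - A.1) j| ≤ ε / 2 * σ := by
    refine hPψ.trans ?_
    rw [Finset.card_univ, Fintype.card_fin]
    calc _ ≤ ε / (2 * ((m - 1 : ℕ) + 1)) * ((m - 1 : ℕ) + 1) * σ := by gcongr; simp
      _ = ε / 2 * σ := by field_simp
  calc _ = |(ψ B - ψ P) + (ψ P - ψ A - ∑ j, w A₀ j * (B.1 - A.1) j)| := by
        congr 1
        simp only [Pi.sub_apply]
        ring
    _ ≤ ε * σ := (abs_add_le _ _).trans (by linarith)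

end Carnot
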